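/- arXiv:math/0205240 — 2 statements merged into one kernel-verified Lean document; each statement's English description precedes it below -/
import Mathlib

section
/- Let a_{ij} : ℝ³ × ℝ³ → ℝ (i, j ∈ {1,2,3}) be smooth functions of (x,y) satisfying ∂a_{ij}/∂x_k = ∂a_{kj}/∂x_i and ∂a_{ij}/∂y_k = ∂a_{ik}/∂y_j for all i, j, k ∈ {1,2,3}. Then there exists a smooth function φ : ℝ³ × ℝ³ → ℝ such that a_{ij} = ∂²φ/∂x_i∂y_j on all of ℝ³ × ℝ³ for all i, j. (Consequently, every closed 2-form of the type Σ_{i,j} a_{ij}(x,y) dx_i∧dy_j admits a potential φ with a_{ij} = ∂²φ/∂x_i∂y_j.) -/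
/-- Partial derivative in the `i`-th `x`-direction on `ℝ³ × ℝ³`. -/
noncomputable def pdx (i : Fin 3) (g : (Fin 3 → ℝ) × (Fin 3 → ℝ) → ℝ)
    (p : (Fin 3 → ℝ) × (Fin 3 → ℝ)) : ℝ :=
  fderiv ℝ g p ((Pi.single i 1 : Fin 3 → ℝ), 0)

/-- Partial derivative in the `j`-th `y`-direction on `ℝ³ × ℝ³`. -/
noncomputable def pdy (j : Fin 3) (g : (Fin 3 → ℝ) × (Fin 3 → ℝ) → ℝ)
    (p : (Fin 3 → ℝ) × (Fin 3 → ℝ)) : ℝ :=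
  fderiv ℝ g p (0, (Pi.single j 1 : Fin 3 → ℝ))

/-- The partial derivative in the first variable of a `C^(n + 1)` function is jointly `C^n`. -/
theorem contDiff_fderiv_partial {E F : Type*} [NormedAddCommGroup E] [NormedSpace ℝ E]
    [NormedAddCommGroup F] [NormedSpace ℝ F] {f : E → ℝ → F} {m n : WithTop ℕ∞}
    (hf : ContDiff ℝ n (fun q : E × ℝ => f q.1 q.2)) (hmn : m + 1 ≤ n) :
    ContDiff ℝ m (fun q : E × ℝ => fderiv ℝ (fun x => f x q.2) q.1) :=
  ContDiff.fderiv (f := fun (q : E × ℝ) x => f x q.2)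
    (hf.comp (contDiff_snd.prodMk (contDiff_snd.comp contDiff_fst))) contDiff_fst hmn

theorem continuous_fderiv_partial {E F : Type*} [NormedAddCommGroup E] [NormedSpace ℝ E]
    [NormedAddCommGroup F] [NormedSpace ℝ F] {f : E → ℝ → F}
    (hf : ContDiff ℝ 1 (fun q : E × ℝ => f q.1 q.2)) :
    Continuous (fun q : E × ℝ => fderiv ℝ (fun x => f x q.2) q.1) :=
  (contDiff_fderiv_partial (m := 0) hf (by simp)).continuous

open MeasureTheory Set in
/-- Differentiation under the integral sign for a `C¹` integrand on a compact interval. -/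
theorem hasFDerivAt_intervalIntegral_of_contDiff {E F : Type*} [NormedAddCommGroup E]
    [NormedSpace ℝ E] [ProperSpace E] [NormedAddCommGroup F] [NormedSpace ℝ F]
    {f : E → ℝ → F} (hf : ContDiff ℝ 1 (fun q : E × ℝ => f q.1 q.2)) (a b : ℝ) (x₀ : E) :
    HasFDerivAt (fun x => ∫ t in a..b, f x t)
      (∫ t in a..b, fderiv ℝ (fun x => f x t) x₀) x₀ := by
  have hc := continuous_fderiv_partial hf
  have hfx (x : E) : Continuous (f x) := hf.continuous.comp (Continuous.prodMk_right x)
  obtain ⟨C, hC⟩ := ((isCompact_closedBall x₀ 1).prod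
    (isCompact_uIcc (a := a) (b := b))).exists_bound_of_continuousOn hc.continuousOn
  refine intervalIntegral.hasFDerivAt_integral_of_dominated_of_fderiv_le
    (F' := fun x t => fderiv ℝ (fun x => f x t) x) (bound := fun _ => C)
    (Metric.closedBall_mem_nhds x₀ one_pos)
    (.of_forall fun x => (hfx x).aestronglyMeasurable) ((hfx x₀).intervalIntegrable _ _)
    (hc.comp (Continuous.prodMk_right x₀)).aestronglyMeasurable
    (.of_forall fun t ht x hx => hC (x, t) ⟨hx, uIoc_subset_uIcc ht⟩)
    intervalIntegrable_const (.of_forall fun t _ x _ => ?_)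
  have : ContDiff ℝ 1 (fun x => f x t) := hf.comp (contDiff_id.prodMk contDiff_const)
  exact (this.differentiable one_ne_zero x).hasFDerivAt

theorem fderiv_intervalIntegral_apply_of_contDiff {E F : Type*} [NormedAddCommGroup E]
    [NormedSpace ℝ E] [ProperSpace E] [NormedAddCommGroup F] [NormedSpace ℝ F] [CompleteSpace F]
    {f : E → ℝ → F} (hf : ContDiff ℝ 1 (fun q : E × ℝ => f q.1 q.2)) (a b : ℝ) (x v : E) :
    fderiv ℝ (fun x => ∫ t in a..b, f x t) x v =
      ∫ t in a..b, fderiv ℝ (fun x => f x t) x v := by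
  have hc := (continuous_fderiv_partial hf).comp (Continuous.prodMk_right x)
  rw [(hasFDerivAt_intervalIntegral_of_contDiff hf a b x).fderiv]
  exact ContinuousLinearMap.intervalIntegral_apply (hc.intervalIntegrable _ _) v

/-- An integral over a compact interval depends smoothly on parameters if its integrand does. -/
theorem contDiff_intervalIntegral_of_contDiff {E F : Type*} [NormedAddCommGroup E]
    [NormedSpace ℝ E] [FiniteDimensional ℝ E] [NormedAddCommGroup F] [NormedSpace ℝ F]
    [CompleteSpace F] {f : E → ℝ → F}
    (hf : ContDiff ℝ (⊤ : ℕ∞) (fun q : E × ℝ => f q.1 q.2)) (a b : ℝ) :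
    ContDiff ℝ (⊤ : ℕ∞) (fun x => ∫ t in a..b, f x t) := by
  have : ProperSpace E := FiniteDimensional.proper_real E
  refine contDiff_iff_forall_nat_le.2 fun n _ => ?_
  induction n generalizing f with
  | zero =>
    have hf1 := hf.of_le (m := 1) (by exact_mod_cast le_top)
    exact contDiff_zero.2 (continuous_iff_continuousAt.2 fun x =>
      (hasFDerivAt_intervalIntegral_of_contDiff hf1 a b x).continuousAt)
  | succ n ih =>
    have hf1 := hf.of_le (m := 1) (by exact_mod_cast le_top)
    refine (contDiff_succ_iff_fderiv_apply (n := n)).2 ⟨fun x =>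
      (hasFDerivAt_intervalIntegral_of_contDiff hf1 a b x).differentiableAt, by simp,
      fun v => ?_⟩
    simp only [fderiv_intervalIntegral_apply_of_contDiff hf1]
    exact ih ((contDiff_fderiv_partial hf (by simp)).clm_apply contDiff_const)
      (by exact_mod_cast le_top)

section RadialPrimitive

variable {ι P : Type*} [Fintype ι] [NormedAddCommGroup P] [NormedSpace ℝ P]

/-- The dilation by `s` along the directions `e i` with coordinate functionals `c i`. -/
noncomputable def partialDilation (e : ι → P) (c : ι → P →L[ℝ] ℝ) (s : ℝ) (p : P) : P :=
  p + (s - 1) • ∑ i, c i p • e i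

/-- The integral of the partial `1`-form `∑ i, b i • c i` along the segment that joins the
projection of `p` to its partial dilation by `1`. -/
noncomputable def radialPrimitive (e : ι → P) (c : ι → P →L[ℝ] ℝ) (b : ι → P → ℝ) (p : P) : ℝ :=
  ∫ s in (0 : ℝ)..1, ∑ i, c i p * b i (partialDilation e c s p)

variable {e : ι → P} {c : ι → P →L[ℝ] ℝ} {b : ι → P → ℝ}

theorem contDiff_radialPrimitive_integrand (hb : ∀ i, ContDiff ℝ (⊤ : ℕ∞) (b i)) :
    ContDiff ℝ (⊤ : ℕ∞)
      (fun q : P × ℝ => ∑ i, c i q.1 * b i (partialDilation e c q.2 q.1)) := by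
  unfold partialDilation
  fun_prop

theorem contDiff_radialPrimitive [FiniteDimensional ℝ P] (hb : ∀ i, ContDiff ℝ (⊤ : ℕ∞) (b i)) :
    ContDiff ℝ (⊤ : ℕ∞) (radialPrimitive e c b) :=
  contDiff_intervalIntegral_of_contDiff (contDiff_radialPrimitive_integrand hb) 0 1

theorem fderiv_radialPrimitive [FiniteDimensional ℝ P]
    (hb : ∀ i, ContDiff ℝ (⊤ : ℕ∞) (b i)) (p v : P) :
    fderiv ℝ (radialPrimitive e c b) p v =
      ∫ s in (0 : ℝ)..1, ∑ i, (c i p *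
        fderiv ℝ (b i) (partialDilation e c s p) (partialDilation e c s v) +
          c i v * b i (partialDilation e c s p)) := by
  have hsm := (contDiff_radialPrimitive_integrand (e := e) (c := c) hb).of_le
    (m := 1) (by exact_mod_cast le_top)
  have : ProperSpace P := FiniteDimensional.proper_real P
  refine (fderiv_intervalIntegral_apply_of_contDiff hsm 0 1 p v).trans ?_
  congr 1
  funext s
  have hd : HasFDerivAt (partialDilation e c s)
      (ContinuousLinearMap.id ℝ P + (s - 1) • ∑ i, (c i).smulRight (e i)) p := by
    have := (ContinuousLinearMap.id ℝ P + (s - 1) • ∑ i, (c i).smulRight (e i)).hasFDerivAt (x := p)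
    convert this using 1
    ext x
    simp [partialDilation]
  have key (i : ι) := (c i).hasFDerivAt (x := p) |>.fun_mul
    ((((hb i).differentiable (by simp)) (partialDilation e c s p)).hasFDerivAt.comp p hd)
  have := (HasFDerivAt.fun_sum (u := Finset.univ) fun i _ => key i).fderiv
  simp only [Function.comp_apply] at this
  rw [this]
  simp [partialDilation, mul_comm, mul_add]

/-- If `∑ i, b i • c i` is closed along the directions `e i`, its radial primitive has partial
derivatives `b i`. -/
theorem fderiv_radialPrimitive_apply [FiniteDimensional ℝ P] [DecidableEq ι]
    (hb : ∀ i, ContDiff ℝ (⊤ : ℕ∞) (b i))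
    (hce : ∀ i k, c i (e k) = if i = k then 1 else 0)
    (hclosed : ∀ i k p, fderiv ℝ (b i) p (e k) = fderiv ℝ (b k) p (e i)) (k : ι) (p : P) :
    fderiv ℝ (radialPrimitive e c b) p (e k) = b k p := by
  rw [fderiv_radialPrimitive hb]
  have hdil (s : ℝ) : partialDilation e c s (e k) = s • e k := by
    simp [partialDilation, hce, sub_smul]
  have hderiv (s : ℝ) : HasDerivAt (fun s => s * b k (partialDilation e c s p))
      (∑ i, (c i p * fderiv ℝ (b i) (partialDilation e c s p) (partialDilation e c s (e k)) +
          c i (e k) * b i (partialDilation e c s p))) s := by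
    have hd : HasDerivAt (fun s => partialDilation e c s p) (∑ i, c i p • e i) s := by
      simpa [partialDilation] using
        (((hasDerivAt_id s).sub_const 1).smul_const (∑ i, c i p • e i)).const_add p
    have := (hasDerivAt_id' s).fun_mul
      ((((hb k).differentiable (by simp)) (partialDilation e c s p)).hasFDerivAt.comp_hasDerivAt
        s hd)
    refine this.congr_deriv (Eq.symm ?_)
    simp [hdil, hce, Finset.sum_add_distrib, hclosed _ k, Finset.mul_sum]
    rw [add_comm]
    congr 1
    exact Finset.sum_congr rfl fun i _ => by ring
  rw [intervalIntegral.integral_eq_sub_of_hasDerivAt (fun s _ => hderiv s)]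
  · simp [partialDilation]
  · refine Continuous.intervalIntegrable ?_ _ _
    have hD (i : ι) : Continuous (fderiv ℝ (b i)) := (hb i).continuous_fderiv (by simp)
    have hB (i : ι) : Continuous (b i) := (hb i).continuous
    unfold partialDilation
    fun_prop

theorem fderiv_radialPrimitive_apply_of_coord_eq_zero [FiniteDimensional ℝ P]
    (hb : ∀ i, ContDiff ℝ (⊤ : ℕ∞) (b i)) {v : P} (hv : ∀ i, c i v = 0) (p : P) :
    fderiv ℝ (radialPrimitive e c b) p v =
      ∫ s in (0 : ℝ)..1, ∑ i, c i p * fderiv ℝ (b i) (partialDilation e c s p) v := by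
  simp [fderiv_radialPrimitive hb, hv, partialDilation]

end RadialPrimitive

/-- Smooth functions `a_{ij}(x,y)` with `∂a_{ij}/∂x_k = ∂a_{kj}/∂x_i` and
`∂a_{ij}/∂y_k = ∂a_{ik}/∂y_j` are the mixed second partials `∂²φ/∂x_i∂y_j` of a single
smooth potential `φ`; equivalently, a closed 2-form `Σ a_{ij} dx_i∧dy_j` admits a
potential. -/
theorem mixed_partials_potential
    (a : Fin 3 → Fin 3 → (Fin 3 → ℝ) × (Fin 3 → ℝ) → ℝ)
    (ha : ∀ i j, ContDiff ℝ (⊤ : ℕ∞) (a i j))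
    (hx : ∀ i j k, ∀ p, pdx k (a i j) p = pdx i (a k j) p)
    (hy : ∀ i j k, ∀ p, pdy k (a i j) p = pdy j (a i k) p) :
    ∃ φ : (Fin 3 → ℝ) × (Fin 3 → ℝ) → ℝ, ContDiff ℝ (⊤ : ℕ∞) φ ∧
      ∀ i j, ∀ p, a i j p = pdx i (pdy j φ) p := by
  let ex : Fin 3 → (Fin 3 → ℝ) × (Fin 3 → ℝ) := fun i => (Pi.single i 1, 0)
  let ey : Fin 3 → (Fin 3 → ℝ) × (Fin 3 → ℝ) := fun j => (0, Pi.single j 1)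
  let cx : Fin 3 → (Fin 3 → ℝ) × (Fin 3 → ℝ) →L[ℝ] ℝ := fun i =>
    (ContinuousLinearMap.proj i).comp (ContinuousLinearMap.fst ℝ _ _)
  let cy : Fin 3 → (Fin 3 → ℝ) × (Fin 3 → ℝ) →L[ℝ] ℝ := fun j =>
    (ContinuousLinearMap.proj j).comp (ContinuousLinearMap.snd ℝ _ _)
  let u : Fin 3 → (Fin 3 → ℝ) × (Fin 3 → ℝ) → ℝ := fun j =>
    radialPrimitive ex cx (fun i => a i j)
  have hu (j) : ContDiff ℝ (⊤ : ℕ∞) (u j) := contDiff_radialPrimitive fun i => ha i j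
  have hux (i j p) : fderiv ℝ (u j) p (ex i) = a i j p :=
    fderiv_radialPrimitive_apply (fun i => ha i j)
      (fun i k => by simp [cx, Pi.single_apply])
      (fun i k p => hx i j k p) i p
  have huy (j k p) : fderiv ℝ (u j) p (ey k) = fderiv ℝ (u k) p (ey j) := by
    rw [fderiv_radialPrimitive_apply_of_coord_eq_zero (fun i => ha i j)
        (fun i => by simp [cx, ey]),
      fderiv_radialPrimitive_apply_of_coord_eq_zero (fun i => ha i k)
        (fun i => by simp [cx, ey])]
    refine intervalIntegral.integral_congr fun s _ => Finset.sum_congr rfl fun i _ => ?_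
    exact congrArg _ (hy i j k _)
  refine ⟨radialPrimitive ey cy u, contDiff_radialPrimitive hu, fun i j p => ?_⟩
  have hφ : pdy j (radialPrimitive ey cy u) = u j := funext fun q =>
    fderiv_radialPrimitive_apply hu (fun i k => by simp [cy, ey, Pi.single_apply]) huy j q
  rw [hφ]
  exact (hux i j p).symm
end

section
/- Let n ≥ 3 be odd, let a ≥ 0 and b ∈ ℝ, and let U be the open set of points x ∈ ℝⁿ such that Σ_{1≤i<j≤n} x_i x_j > 0 and b + ξⁿ/(n−1) > 0 for every ξ in the closed interval with endpoints a and p(x), where p(x) = √(Σ_{1≤i<j≤n} x_i x_j). Then the function f(x) = 2·∫_a^{p(x)} (b + ξⁿ/(n−1))^{1/n} dξ is smooth on U and its Hessian determinant equals 1 on U: det(∂²f/∂x_i∂x_j)(x) = 1 for all x ∈ U; i.e. f is a regular solution of the classical Monge–Ampère equation hess(f) = 1. -/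
/-- Partial derivative of `g : ℝⁿ → ℝ` in the `i`-th coordinate direction. -/
noncomputable def partialD {n : ℕ} (i : Fin n) (g : (Fin n → ℝ) → ℝ)
    (v : Fin n → ℝ) : ℝ :=
  fderiv ℝ g v (Pi.single i 1)

/-- The second elementary symmetric polynomial in terms of power sums. -/
theorem sum_lt_mul_eq {n : ℕ} (x : Fin n → ℝ) :
    (∑ i, ∑ j, if i < j then x i * x j else 0) = ((∑ i, x i) ^ 2 - ∑ i, x i ^ 2) / 2 := by
  have hsplit : ∀ i j : Fin n, x i * x j = (if i < j then x i * x j else 0)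
      + (if j < i then x j * x i else 0) + (if i = j then x i ^ 2 else 0) := by
    intro i j
    rcases lt_trichotomy i j with h | h | h
    · simp [h, h.not_gt, h.ne]
    · subst h; simp [sq]
    · simp [h, h.not_gt, h.ne', mul_comm]
  have hsq : (∑ i, x i) ^ 2 = (∑ i, ∑ j, if i < j then x i * x j else 0)
      + (∑ i, ∑ j, if i < j then x i * x j else 0) + ∑ i, x i ^ 2 := by
    rw [sq, Finset.sum_mul_sum, Finset.sum_congr rfl fun i _ =>
      Finset.sum_congr rfl fun j _ => hsplit i j]
    simp only [Finset.sum_add_distrib]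
    congr 1
    · congr 1
      exact Finset.sum_comm
    · simp
  rw [hsq]
  ring

theorem hasFDerivAt_sum_lt_mul {n : ℕ} (x : Fin n → ℝ) :
    ∃ L : (Fin n → ℝ) →L[ℝ] ℝ,
      HasFDerivAt (fun x : Fin n → ℝ => ∑ i, ∑ j, if i < j then x i * x j else 0) L x ∧
      ∀ k, L (Pi.single k 1) = (∑ i, x i) - x k := by
  simp only [sum_lt_mul_eq]
  have hproj : ∀ i : Fin n, HasFDerivAt (fun x : Fin n → ℝ => x i)
      (ContinuousLinearMap.proj (R := ℝ) (φ := fun _ : Fin n => ℝ) i) x :=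
    fun i => hasFDerivAt_apply i x
  have hsum := HasFDerivAt.fun_sum (u := Finset.univ) fun i _ => hproj i
  have hsum2 := HasFDerivAt.fun_sum (u := Finset.univ) fun i _ => (hproj i).pow 2
  refine ⟨_, ((hsum.pow 2).sub hsum2).mul_const (2⁻¹ : ℝ), fun k => ?_⟩
  simp [Pi.single_apply]
  ring

/-- The determinant of the Hessian matrix of the second elementary symmetric polynomial. -/
theorem det_of_one_sub_one (n : ℕ) (hodd : Odd n) :
    Matrix.det (Matrix.of fun i j : Fin n => (1 : ℝ) - if i = j then 1 else 0) = n - 1 := by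
  have hM : (Matrix.of fun i j : Fin n => (1 : ℝ) - if i = j then 1 else 0)
      = -(1 + Matrix.replicateCol Unit (fun _ : Fin n => (-1 : ℝ))
        * Matrix.replicateRow Unit fun _ : Fin n => (1 : ℝ)) := by
    ext i j
    simp [Matrix.mul_apply, Matrix.one_apply, sub_eq_add_neg]
  rw [hM, Matrix.det_neg, Matrix.det_one_add_replicateCol_mul_replicateRow]
  simp [hodd.neg_one_pow, dotProduct]
  ring

/-- The Hessian determinant of a function of the second elementary symmetric polynomial. -/
theorem det_hessian_comp_sum_lt_mul {n : ℕ} (hodd : Odd n) (x : Fin n → ℝ) (A B : ℝ)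
    (hA : A ≠ 0) :
    Matrix.det (Matrix.of fun i j : Fin n =>
      A * (1 - if i = j then 1 else 0) + B * ((∑ k, x k) - x i) * ((∑ k, x k) - x j))
      = (n - 1) * (A ^ n + A ^ (n - 1) * B *
        (2 * ∑ i, ∑ j, if i < j then x i * x j else 0)) := by
  have hM : (Matrix.of fun i j : Fin n =>
      A * (1 - if i = j then 1 else 0) + B * ((∑ k, x k) - x i) * ((∑ k, x k) - x j))
      = (Matrix.of fun i j : Fin n => (1 : ℝ) - if i = j then 1 else 0)
        * (A • (1 + Matrix.replicateCol Unit (fun i => B / A * x i)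
          * Matrix.replicateRow Unit fun j => (∑ k, x k) - x j)) := by
    ext i j
    simp only [Matrix.of_apply, Matrix.mul_smul, Matrix.smul_apply, Matrix.mul_add,
      Matrix.mul_one, Matrix.add_apply, ← Matrix.mul_assoc, smul_eq_mul]
    simp [Matrix.mul_apply, sub_mul, Finset.sum_sub_distrib, ← Finset.mul_sum]
    field_simp
  have hdot : (fun j => (∑ k, x k) - x j) ⬝ᵥ (fun i => B / A * x i)
      = B / A * (2 * ∑ i, ∑ j, if i < j then x i * x j else 0) := by
    rw [sum_lt_mul_eq]
    have : ∀ i, ((∑ k, x k) - x i) * (B / A * x i)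
        = B / A * ((∑ k, x k) * x i - x i ^ 2) := fun i => by ring
    simp only [dotProduct, this, ← Finset.mul_sum, Finset.sum_sub_distrib]
    ring
  rw [hM, Matrix.det_mul, det_of_one_sub_one n hodd, Matrix.det_smul,
    Matrix.det_one_add_replicateCol_mul_replicateRow, hdot, Fintype.card_fin]
  obtain ⟨m, rfl⟩ : ∃ m, n = m + 1 := ⟨n - 1, by have := hodd.pos; omega⟩
  simp only [Nat.add_sub_cancel]
  field_simp
  ring

theorem partialD_comp_sum_lt_mul {n : ℕ} {G : ℝ → ℝ} {A : ℝ} (x : Fin n → ℝ) (j : Fin n)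
    (hG : HasDerivAt G A (∑ i, ∑ j, if i < j then x i * x j else 0)) :
    partialD j (fun x : Fin n → ℝ => G (∑ i, ∑ j, if i < j then x i * x j else 0)) x
      = A * ((∑ i, x i) - x j) := by
  obtain ⟨L, hL, hLk⟩ := hasFDerivAt_sum_lt_mul x
  have h := hG.comp_hasFDerivAt x hL
  unfold partialD
  rw [show (fun x : Fin n → ℝ => G (∑ i, ∑ j, if i < j then x i * x j else 0))
    = G ∘ fun x : Fin n → ℝ => ∑ i, ∑ j, if i < j then x i * x j else 0 from rfl, h.fderiv]
  simp [hLk]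

theorem partialD_partialD_comp_sum_lt_mul {n : ℕ} {G A : ℝ → ℝ} {B : ℝ} (x : Fin n → ℝ)
    (i j : Fin n)
    (hG : ∀ᶠ t in nhds (∑ i, ∑ j, if i < j then x i * x j else 0), HasDerivAt G (A t) t)
    (hA : HasDerivAt A B (∑ i, ∑ j, if i < j then x i * x j else 0)) :
    partialD i (partialD j
        (fun x : Fin n → ℝ => G (∑ i, ∑ j, if i < j then x i * x j else 0))) x
      = A (∑ i, ∑ j, if i < j then x i * x j else 0) * (1 - if i = j then 1 else 0)
        + B * ((∑ k, x k) - x i) * ((∑ k, x k) - x j) := by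
  obtain ⟨L, hL, hLk⟩ := hasFDerivAt_sum_lt_mul x
  have heq : partialD j (fun x : Fin n → ℝ => G (∑ i, ∑ j, if i < j then x i * x j else 0))
      =ᶠ[nhds x] fun y => A (∑ i, ∑ j, if i < j then y i * y j else 0) * ((∑ k, y k) - y j) := by
    filter_upwards [hL.continuousAt.eventually hG] with y hy
    exact partialD_comp_sum_lt_mul y j hy
  have hproj : ∀ i : Fin n, HasFDerivAt (fun x : Fin n → ℝ => x i)
      (ContinuousLinearMap.proj (R := ℝ) (φ := fun _ : Fin n => ℝ) i) x :=
    fun i => hasFDerivAt_apply i x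
  have hlin := (HasFDerivAt.fun_sum (u := Finset.univ) fun i _ => hproj i).sub (hproj j)
  have h := (hA.comp_hasFDerivAt x hL).mul hlin
  unfold partialD at heq ⊢
  rw [heq.fderiv_eq]
  erw [h.fderiv]
  simp [hLk, Pi.single_apply, eq_comm]
  ring

theorem hasDerivAt_two_mul_integral_sqrt {g : ℝ → ℝ} (hg : Continuous g) (a : ℝ) {t : ℝ}
    (ht : 0 < t) :
    HasDerivAt (fun t => 2 * ∫ ξ in a..√t, g ξ) (g √t / √t) t := by
  have h := (hg.integral_hasStrictDerivAt a √t).hasDerivAt.comp t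
    (Real.hasDerivAt_sqrt ht.ne')
  refine (h.const_mul 2).congr_deriv ?_
  field_simp

theorem hasDerivAt_comp_sqrt_div_sqrt {g : ℝ → ℝ} {g' t : ℝ} (ht : 0 < t)
    (hg : HasDerivAt g g' √t) :
    HasDerivAt (fun t => g √t / √t) ((g' - g √t / √t) / (2 * t)) t := by
  have hs : √t ≠ 0 := (Real.sqrt_pos.2 ht).ne'
  have hsqrt := Real.hasDerivAt_sqrt ht.ne'
  refine ((hg.comp t hsqrt).div hsqrt hs).congr_deriv ?_
  have hsq : √t ^ 2 = t := Real.sq_sqrt ht.le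
  simp only [Function.comp_apply]
  rw [← hsq, Real.sqrt_sq (Real.sqrt_nonneg t)]
  field_simp

theorem contDiffOn_integral_of_continuous {g : ℝ → ℝ} (hg : Continuous g) (a : ℝ) {s : Set ℝ}
    (hs : IsOpen s) (hgs : ContDiffOn ℝ (⊤ : ℕ∞) g s) :
    ContDiffOn ℝ (⊤ : ℕ∞) (fun t => ∫ ξ in a..t, g ξ) s := by
  have hderiv : ∀ t, HasDerivAt (fun t => ∫ ξ in a..t, g ξ) (g t) t :=
    fun t => (hg.integral_hasStrictDerivAt a t).hasDerivAt
  rw [contDiffOn_infty_iff_deriv_of_isOpen hs]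
  refine ⟨fun t _ => (hderiv t).differentiableAt.differentiableWithinAt, ?_⟩
  rwa [show deriv (fun t => ∫ ξ in a..t, g ξ) = g from funext fun t => (hderiv t).deriv]

/-- For odd `n ≥ 3`, the function `f(x) = 2∫_a^{p(x)} (b + ξⁿ/(n−1))^{1/n} dξ`, with
`p(x) = √(Σ_{i<j} x_i x_j)`, is a smooth regular solution of the classical
Monge–Ampère equation `hess(f) = 1` on the indicated open set. -/
theorem hessian_one_explicit_solution
    (n : ℕ) (hn3 : 3 ≤ n) (hodd : Odd n) (a : ℝ) (ha : 0 ≤ a) (b : ℝ) :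
    ContDiffOn ℝ (⊤ : ℕ∞)
      (fun x : Fin n → ℝ =>
        2 * ∫ ξ in a..(Real.sqrt (∑ i, ∑ j, if i < j then x i * x j else 0)),
          (b + ξ ^ n / ((n : ℝ) - 1)) ^ ((1 : ℝ) / n))
      {x : Fin n → ℝ | 0 < (∑ i, ∑ j, if i < j then x i * x j else 0) ∧
        ∀ ξ ∈ Set.uIcc a (Real.sqrt (∑ i, ∑ j, if i < j then x i * x j else 0)),
          0 < b + ξ ^ n / ((n : ℝ) - 1)} ∧
    ∀ x ∈ {x : Fin n → ℝ | 0 < (∑ i, ∑ j, if i < j then x i * x j else 0) ∧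
        ∀ ξ ∈ Set.uIcc a (Real.sqrt (∑ i, ∑ j, if i < j then x i * x j else 0)),
          0 < b + ξ ^ n / ((n : ℝ) - 1)},
      Matrix.det (Matrix.of fun i j : Fin n =>
        partialD i (partialD j
          (fun x : Fin n → ℝ =>
            2 * ∫ ξ in a..(Real.sqrt (∑ i, ∑ j, if i < j then x i * x j else 0)),
              (b + ξ ^ n / ((n : ℝ) - 1)) ^ ((1 : ℝ) / n))) x) = 1 := by
  have hn0 : (n : ℝ) ≠ 0 := by positivity
  have hn1 : (0 : ℝ) < (n : ℝ) - 1 := by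
    have : (3 : ℝ) ≤ n := by exact_mod_cast hn3
    linarith
  set φ : ℝ → ℝ := fun ξ => b + ξ ^ n / ((n : ℝ) - 1) with hφ
  set g : ℝ → ℝ := fun ξ => φ ξ ^ ((1 : ℝ) / n) with hg
  have hφc : ContDiff ℝ (⊤ : ℕ∞) φ := by fun_prop
  have hgc : Continuous g := hφc.continuous.rpow_const fun _ => Or.inr (by positivity)
  have hgs : ContDiffOn ℝ (⊤ : ℕ∞) g {ξ | 0 < φ ξ} :=
    hφc.contDiffOn.rpow_const_of_ne fun ξ hξ => ne_of_gt hξ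
  have hs : IsOpen {ξ | 0 < φ ξ} := isOpen_lt continuous_const hφc.continuous
  refine ⟨?_, fun x ⟨hq, hpos⟩ => ?_⟩
  · refine contDiffOn_const.mul
      ((contDiffOn_integral_of_continuous hgc a hs hgs).comp ?_ fun x hx =>
        hx.2 _ Set.right_mem_uIcc)
    refine ContDiffOn.sqrt ?_ fun x hx => hx.1.ne'
    simp only [sum_lt_mul_eq]
    fun_prop
  · set q : ℝ := ∑ i, ∑ j, if i < j then x i * x j else 0 with hqdef
    have hp : 0 < √q := Real.sqrt_pos.2 hq
    have hφp : 0 < φ √q := hpos _ Set.right_mem_uIcc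
    have hgp : 0 < g √q := Real.rpow_pos_of_pos hφp _
    have hgd : HasDerivAt g (deriv g √q) √q :=
      ((hgs.contDiffAt (hs.mem_nhds hφp)).differentiableAt (by simp)).hasDerivAt
    have hode : g √q ^ (n - 1) * deriv g √q = √q ^ (n - 1) / ((n : ℝ) - 1) := by
      have hpow : (fun ξ => g ξ ^ n) =ᶠ[nhds √q] φ := by
        filter_upwards [hs.mem_nhds hφp] with ξ hξ
        rw [hg, ← Real.rpow_natCast, ← Real.rpow_mul (le_of_lt hξ), one_div_mul_cancel hn0,
          Real.rpow_one]
      have hφd : HasDerivAt φ (n * √q ^ (n - 1) / ((n : ℝ) - 1)) √q :=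
        ((hasDerivAt_pow n √q).div_const _).const_add b
      have := (hgd.pow n).unique (hφd.congr_of_eventuallyEq hpow)
      rw [mul_assoc, mul_div_assoc] at this
      exact mul_left_cancel₀ hn0 this
    have hG : ∀ᶠ t in nhds q, HasDerivAt (fun t => 2 * ∫ ξ in a..√t, g ξ) (g √t / √t) t := by
      filter_upwards [lt_mem_nhds hq] with t ht
      exact hasDerivAt_two_mul_integral_sqrt hgc a ht
    have hA := hasDerivAt_comp_sqrt_div_sqrt hq hgd
    have hpart := fun i j => partialD_partialD_comp_sum_lt_mul x i j hG hA
    simp only [hpart]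
    rw [det_hessian_comp_sum_lt_mul hodd x _ _ (div_pos hgp hp).ne', ← hqdef]
    obtain ⟨m, rfl⟩ : ∃ m, n = m + 1 := ⟨n - 1, by omega⟩
    simp only [Nat.add_sub_cancel] at hode ⊢
    calc _ = (((m + 1 : ℕ) : ℝ) - 1) * (g √q ^ m * deriv g √q / √q ^ m) := by
          rw [div_pow, div_pow, pow_succ (g √q), pow_succ √q]
          generalize deriv g √q = d
          generalize g √q = c at hgp ⊢
          generalize √q = r at hp ⊢
          field_simp
          ring
      _ = 1 := by
          rw [hode]
          field_simp
end
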